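/- arXiv:2002.01586 — 2 statements merged into one kernel-verified Lean document; each statement's English description precedes it below -/
import Mathlib

section
/- Let X ∈ ℝ^{n×p} satisfy |X_{ij}| ≤ M for all i,j, let y ∈ {−1,+1}^n, and suppose κ_{n,ℓ₁} > 0. Fix 0 < ε < 1 and run the boosting iteration with q = 1 and shrinkage factor β = ε/M². Then for every integer T with T ≥ log(1.01·n·e) · 2·M²·ε^{−2} / κ_{n,ℓ₁}², the iterate θ_T satisfies θ_T ≠ 0 and κ_{n,ℓ₁} ≥ min_{1≤i≤n} y_i·x_iᵀθ_T / ‖θ_T‖₁ > κ_{n,ℓ₁}·(1 − ε). -/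
open Filter

noncomputable section

/-- The ℓq norm `(∑ |u j|^q)^{1/q}` on `Fin p → ℝ`. -/
def lqNorm (q : ℝ) {p : ℕ} (u : Fin p → ℝ) : ℝ := (∑ j, |u j| ^ q) ^ (1 / q)

/-- The ℓq⋆ norm for the conjugate exponent `1/q + 1/q⋆ = 1`, with the convention `q⋆ = ∞`
(sup norm) when `q = 1`. -/
def lqDualNorm (q : ℝ) {p : ℕ} (u : Fin p → ℝ) : ℝ :=
  if q = 1 then ⨆ j, |u j| else (∑ j, |u j| ^ (q / (q - 1))) ^ ((q - 1) / q)

/-- `p^{2/q⋆}`, with the convention `p^{2/q⋆} = 1` when `q = 1`. -/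
def pPow (q : ℝ) (p : ℕ) : ℝ := if q = 1 then 1 else (p : ℝ) ^ (2 * (q - 1) / q)

/-- The max-ℓq-margin `κ_{n,ℓq}` of the data. -/
def maxMarginQ (q : ℝ) {n p : ℕ} (X : Fin n → Fin p → ℝ) (y : Fin n → ℝ) : ℝ :=
  sSup {m : ℝ | ∃ θ : Fin p → ℝ, lqNorm q θ ≤ 1 ∧ m = ⨅ i, y i * ∑ j, X i j * θ j}

open ProbabilityTheory MeasureTheory in
/-- Hoeffding's lemma for a finitely supported distribution `w` and values `m i ∈ [-M, M]`. -/
theorem sum_mul_exp_le {n : ℕ} (w m : Fin n → ℝ) (M a : ℝ)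
    (hw : ∀ i, 0 ≤ w i) (hw1 : ∑ i, w i = 1) (hm : ∀ i, |m i| ≤ M) :
    ∑ i, w i * Real.exp (-a * m i) ≤ Real.exp (-a * ∑ i, w i * m i + a ^ 2 * M ^ 2 / 2) := by
  let μ : Measure (Fin n) := ∑ i, ENNReal.ofReal (w i) • Measure.dirac i
  have hint (f : Fin n → ℝ) : ∫ i, f i ∂μ = ∑ i, w i * f i := by
    have hfin (i : Fin n) : IsFiniteMeasure (ENNReal.ofReal (w i) • Measure.dirac i) :=
      Measure.smul_finite _ ENNReal.ofReal_ne_top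
    rw [integral_finsetSum_measure (fun i _ => .of_finite)]
    simp [integral_smul_measure, ENNReal.toReal_ofReal (hw _)]
  have : IsProbabilityMeasure μ := by
    constructor
    simp [μ, ← ENNReal.ofReal_sum_of_nonneg (fun i _ => hw i), hw1]
  have h := (hasSubgaussianMGF_of_mem_Icc (μ := μ) (X := m) (a := -M) (b := M)
    (measurable_of_finite _).aemeasurable
    (.of_forall fun i => abs_le.mp (hm i))).mgf_le (-a)
  rw [mgf, hint, hint] at h
  have hc : (((‖M - -M‖₊ / 2) ^ 2 : NNReal) : ℝ) = M ^ 2 := by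
    push_cast
    rw [Real.norm_eq_abs, div_pow, sq_abs]
    ring
  rw [hc] at h
  rw [Real.exp_add]
  calc ∑ i, w i * Real.exp (-a * m i)
      = Real.exp (-a * ∑ i, w i * m i) *
          ∑ i, w i * Real.exp (-a * (m i - ∑ i, w i * m i)) := by
        rw [Finset.mul_sum]
        refine Finset.sum_congr rfl fun i _ => ?_
        rw [mul_left_comm, ← Real.exp_add]
        ring_nf
    _ ≤ Real.exp (-a * ∑ i, w i * m i) * Real.exp (a ^ 2 * M ^ 2 / 2) := by
        gcongr
        refine h.trans_eq ?_
        ring_nf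

theorem lqNorm_one {p : ℕ} (u : Fin p → ℝ) : lqNorm 1 u = ∑ j, |u j| := by
  simp [lqNorm]

theorem lqDualNorm_one {p : ℕ} (u : Fin p → ℝ) : lqDualNorm 1 u = ⨆ j, |u j| := by
  simp [lqDualNorm]

theorem lqDualNorm_one_nonneg {p : ℕ} (u : Fin p → ℝ) : 0 ≤ lqDualNorm 1 u := by
  rw [lqDualNorm_one]
  exact Real.iSup_nonneg fun j => abs_nonneg _

theorem sum_mul_le_lqDualNorm_one {p : ℕ} (u θ : Fin p → ℝ) :
    ∑ j, u j * θ j ≤ lqDualNorm 1 u * ∑ j, |θ j| := by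
  rw [lqDualNorm_one, Finset.mul_sum]
  refine Finset.sum_le_sum fun j _ => (le_abs_self _).trans ?_
  rw [abs_mul]
  gcongr
  exact le_ciSup (f := fun j => |u j|) (Set.finite_range _).bddAbove j

section Margin

variable {n p : ℕ} {X : Fin n → Fin p → ℝ} {y : Fin n → ℝ}

theorem abs_margin_le {M : ℝ} (hX : ∀ i j, |X i j| ≤ M) (hy : ∀ i, y i = 1 ∨ y i = -1)
    (θ : Fin p → ℝ) (i : Fin n) : |y i * ∑ j, X i j * θ j| ≤ M * ∑ j, |θ j| := by
  have hyi : |y i| = 1 := by rcases hy i with h | h <;> simp [h]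
  rw [abs_mul, hyi, one_mul, Finset.mul_sum]
  refine (Finset.abs_sum_le_sum_abs _ _).trans (Finset.sum_le_sum fun j _ => ?_)
  rw [abs_mul]
  gcongr
  exact hX i j

theorem sum_mul_margin_eq (w : Fin n → ℝ) (θ : Fin p → ℝ) :
    ∑ i, w i * (y i * ∑ j, X i j * θ j) = ∑ j, (∑ i, w i * (y i * X i j)) * θ j := by
  simp_rw [Finset.mul_sum, Finset.sum_mul]
  rw [Finset.sum_comm]
  refine Finset.sum_congr rfl fun j _ => Finset.sum_congr rfl fun i _ => by ring

theorem iInf_margin_le (θ : Fin p → ℝ) (i : Fin n) :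
    ⨅ i, y i * ∑ j, X i j * θ j ≤ y i * ∑ j, X i j * θ j :=
  ciInf_le (Set.finite_range _).bddBelow i

/-- Weak duality: the dual norm of any weighted average of the data bounds the margin. -/
theorem iInf_margin_le_lqDualNorm (w : Fin n → ℝ) (hw : ∀ i, 0 ≤ w i) (hw1 : ∑ i, w i = 1)
    {θ : Fin p → ℝ} (hθ : lqNorm 1 θ ≤ 1) :
    ⨅ i, y i * ∑ j, X i j * θ j ≤ lqDualNorm 1 (fun j => ∑ i, w i * (y i * X i j)) := by
  calc ⨅ i, y i * ∑ j, X i j * θ j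
      = ∑ i, w i * ⨅ i, y i * ∑ j, X i j * θ j := by rw [← Finset.sum_mul, hw1, one_mul]
    _ ≤ ∑ i, w i * (y i * ∑ j, X i j * θ j) :=
        Finset.sum_le_sum fun i _ => mul_le_mul_of_nonneg_left (iInf_margin_le θ i) (hw i)
    _ = ∑ j, (∑ i, w i * (y i * X i j)) * θ j := sum_mul_margin_eq w θ
    _ ≤ _ := sum_mul_le_lqDualNorm_one _ θ
    _ ≤ _ := mul_le_of_le_one_right (lqDualNorm_one_nonneg _) (lqNorm_one θ ▸ hθ)

theorem maxMarginQ_one_le_lqDualNorm (w : Fin n → ℝ) (hw : ∀ i, 0 ≤ w i)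
    (hw1 : ∑ i, w i = 1) :
    maxMarginQ 1 X y ≤ lqDualNorm 1 (fun j => ∑ i, w i * (y i * X i j)) := by
  refine csSup_le ⟨_, 0, by simp [lqNorm_one], rfl⟩ ?_
  rintro _ ⟨θ, hθ, rfl⟩
  exact iInf_margin_le_lqDualNorm w hw hw1 hθ

theorem iInf_margin_div_le_maxMarginQ_one (hn : 0 < n) {θ : Fin p → ℝ}
    (hθ : 0 < ∑ j, |θ j|) :
    (⨅ i, y i * ∑ j, X i j * θ j) / (∑ j, |θ j|) ≤ maxMarginQ 1 X y := by
  have hn' : (n : ℝ) ≠ 0 := by positivity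
  refine le_csSup ⟨lqDualNorm 1 (fun j => ∑ i, (1 / n : ℝ) * (y i * X i j)), ?_⟩
    ⟨fun j => θ j / ∑ j, |θ j|, ?_, ?_⟩
  · rintro _ ⟨θ, hθ, rfl⟩
    exact iInf_margin_le_lqDualNorm (fun _ => (1 / n : ℝ)) (fun _ => by positivity)
      (by simp [hn']) hθ
  · simp_rw [lqNorm_one, abs_div, abs_of_pos hθ]
    rw [← Finset.sum_div, div_self hθ.ne']
  · rw [div_eq_mul_inv, Real.iInf_mul_of_nonneg (inv_nonneg.mpr hθ.le)]
    refine iInf_congr fun i => ?_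
    rw [mul_assoc, Finset.sum_mul]
    simp_rw [div_eq_mul_inv, mul_assoc]

end Margin

/-- **Corollary 5.1 (boosting converges to the max-ℓ₁-margin direction).** -/
theorem boosting_converges_to_max_l1_margin
    (q : ℝ) (hq : q = 1) (n p : ℕ) (hn : 0 < n) (hp : 0 < p)
    (M : ℝ) (hM : 0 < M)
    (X : Fin n → Fin p → ℝ) (hX : ∀ i j, |X i j| ≤ M)
    (y : Fin n → ℝ) (hy : ∀ i, y i = 1 ∨ y i = -1)
    (Z : Fin n → Fin p → ℝ) (hZ : ∀ i j, Z i j = y i * X i j)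
    (hκ : 0 < maxMarginQ q X y)
    (ε : ℝ) (hε0 : 0 < ε) (hε1 : ε < 1)
    (β : ℝ) (hβ : β = ε / M ^ 2)
    -- the boosting iteration with shrinkage factor β
    (θ : ℕ → Fin p → ℝ) (η : ℕ → Fin n → ℝ) (v : ℕ → Fin p → ℝ) (α : ℕ → ℝ)
    (hθ0 : θ 0 = 0) (hη0 : ∀ i, η 0 i = 1 / n)
    (hv_norm : ∀ t : ℕ, lqNorm q (v (t + 1)) = 1)
    (hv_max : ∀ t : ℕ, (∑ j, (∑ i, η t i * Z i j) * v (t + 1) j) =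
      lqDualNorm q (fun j => ∑ i, η t i * Z i j))
    (hα : ∀ t : ℕ, α t = β * lqDualNorm q (fun j => ∑ i, η t i * Z i j))
    (hθ_step : ∀ (t : ℕ) (j : Fin p), θ (t + 1) j = θ t j + α t * v (t + 1) j)
    (hη_step : ∀ (t : ℕ) (i : Fin n), η (t + 1) i =
      η t i * Real.exp (-(α t) * (y i * ∑ j, X i j * v (t + 1) j)) /
        ∑ i', η t i' * Real.exp (-(α t) * (y i' * ∑ j, X i' j * v (t + 1) j)))
    (T : ℕ)
    (hT : Real.log (1.01 * n * Real.exp 1) * (2 * M ^ 2 / ε ^ 2) /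
        maxMarginQ q X y ^ 2 ≤ (T : ℝ)) :
    θ T ≠ 0 ∧
    (⨅ i, y i * ∑ j, X i j * θ T j) / (∑ j, |θ T j|) ≤ maxMarginQ q X y ∧
    maxMarginQ q X y * (1 - ε) < (⨅ i, y i * ∑ j, X i j * θ T j) / (∑ j, |θ T j|) := by
  subst hq
  have : Nonempty (Fin n) := ⟨⟨0, hn⟩⟩
  simp only [hZ] at hv_max hα
  set κ := maxMarginQ 1 X y
  set g : ℕ → ℝ := fun t => lqDualNorm 1 (fun j => ∑ i, η t i * (y i * X i j))
  change ∀ t, _ = g t at hv_max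
  change ∀ t, α t = β * g t at hα
  have hn0 : (0 : ℝ) < n := by exact_mod_cast hn
  have hβ0 : 0 < β := by rw [hβ]; positivity
  set m : (Fin p → ℝ) → Fin n → ℝ := fun u i => y i * ∑ j, X i j * u j with hm
  set S : ℕ → ℝ := fun t => ∑ i, Real.exp (-m (θ t) i) with hS
  have hS0 (t : ℕ) : 0 < S t := Finset.sum_pos (fun _ _ => Real.exp_pos _) Finset.univ_nonempty
  have hm_step (t : ℕ) (i : Fin n) :
      Real.exp (-m (θ (t + 1)) i) =
        Real.exp (-m (θ t) i) * Real.exp (-(α t) * m (v (t + 1)) i) := by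
    rw [← Real.exp_add]
    congr 1
    simp only [hm, hθ_step, mul_add, Finset.sum_add_distrib, mul_left_comm _ (α t),
      ← Finset.mul_sum]
    ring
  have hη (t : ℕ) : ∀ i, η t i = Real.exp (-m (θ t) i) / S t := by
    induction t with
    | zero => intro i; simp [hη0, hS, hm, hθ0]
    | succ t ih =>
      intro i
      have hS' : ∑ i', η t i' * Real.exp (-(α t) * m (v (t + 1)) i') = S (t + 1) / S t := by
        simp only [ih, hS, hm_step, Finset.sum_div]
        exact Finset.sum_congr rfl fun i _ => by ring
      have h := hη_step t i
      change _ = _ * Real.exp (-(α t) * m (v (t + 1)) i) / _ at h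
      rw [h, hS', hm_step, ih, div_mul_eq_mul_div, div_div_div_cancel_right₀ (hS0 t).ne']
  have hη_nonneg (t : ℕ) (i : Fin n) : 0 ≤ η t i := by
    rw [hη]
    exact div_nonneg (Real.exp_pos _).le (hS0 t).le
  have hη_sum (t : ℕ) : ∑ i, η t i = 1 := by
    simp_rw [hη]
    rw [← Finset.sum_div]
    exact div_self (hS0 t).ne'
  have hκg (t : ℕ) : κ ≤ g t := maxMarginQ_one_le_lqDualNorm _ (hη_nonneg t) (hη_sum t)
  have hg0 (t : ℕ) : 0 ≤ g t := hκ.le.trans (hκg t)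
  have hv1 (t : ℕ) : ∑ j, |v (t + 1) j| = 1 := by rw [← lqNorm_one, hv_norm]
  have hS_step (t : ℕ) : S (t + 1) ≤ S t * Real.exp (-(β * (1 - ε / 2) * g t ^ 2)) := by
    have h := sum_mul_exp_le (η t) (m (v (t + 1))) M (α t) (hη_nonneg t) (hη_sum t)
      (fun i => by simpa only [hv1, mul_one] using abs_margin_le hX hy (v (t + 1)) i)
    rw [sum_mul_margin_eq, hv_max, hα] at h
    have he : -(β * g t) * g t + (β * g t) ^ 2 * M ^ 2 / 2
        = -(β * (1 - ε / 2) * g t ^ 2) := by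
      rw [hβ]
      field_simp
      ring
    rw [he] at h
    have hS' : S (t + 1) = S t * ∑ i, η t i * Real.exp (-(β * g t) * m (v (t + 1)) i) := by
      rw [Finset.mul_sum]
      refine Finset.sum_congr rfl fun i _ => ?_
      rw [hm_step, hα, hη, ← mul_assoc (S t), mul_div_cancel₀ _ (hS0 t).ne']
    rw [hS']
    exact mul_le_mul_of_nonneg_left h (hS0 t).le
  have hS_le (t : ℕ) :
      S t ≤ n * Real.exp (-(β * (1 - ε / 2) * ∑ s ∈ Finset.range t, g s ^ 2)) := by
    induction t with
    | zero => simp [hS, hm, hθ0]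
    | succ t ih =>
      refine (hS_step t).trans ((mul_le_mul_of_nonneg_right ih (Real.exp_pos _).le).trans_eq ?_)
      rw [mul_assoc, ← Real.exp_add, Finset.sum_range_succ]
      ring_nf
  have hθ_le (t : ℕ) : ∑ j, |θ t j| ≤ β * ∑ s ∈ Finset.range t, g s := by
    induction t with
    | zero => simp [hθ0]
    | succ t ih =>
      rw [Finset.sum_range_succ, mul_add]
      calc ∑ j, |θ (t + 1) j| ≤ ∑ j, (|θ t j| + α t * |v (t + 1) j|) := by
            refine Finset.sum_le_sum fun j _ => ?_
            rw [hθ_step]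
            refine (abs_add_le _ _).trans_eq ?_
            rw [abs_mul, abs_of_nonneg (a := α t) (by rw [hα]; exact mul_nonneg hβ0.le (hg0 t))]
        _ = ∑ j, |θ t j| + β * g t := by
            rw [Finset.sum_add_distrib, ← Finset.mul_sum, hv1, hα, mul_one]
        _ ≤ _ := by gcongr
  set G := ∑ s ∈ Finset.range T, g s with hG
  have hGT : T * κ ≤ G := by
    simpa using Finset.card_nsmul_le_sum (Finset.range T) g κ fun s _ => hκg s
  have hG2 : κ * G ≤ ∑ s ∈ Finset.range T, g s ^ 2 := by
    rw [hG, Finset.mul_sum]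
    exact Finset.sum_le_sum fun s _ => by nlinarith [hκg s, hg0 s]
  have hlog : Real.log n < Real.log (1.01 * n * Real.exp 1) := by
    refine Real.log_lt_log hn0 ?_
    nlinarith [Real.add_one_le_exp 1]
  have hTlog : Real.log n < β * (ε / 2) * κ * G := by
    rw [div_le_iff₀ (by positivity)] at hT
    calc Real.log n < Real.log (1.01 * n * Real.exp 1) := hlog
      _ = Real.log (1.01 * n * Real.exp 1) * (2 * M ^ 2 / ε ^ 2) * (ε ^ 2 / (2 * M ^ 2)) := by
          field_simp
      _ ≤ T * κ ^ 2 * (ε ^ 2 / (2 * M ^ 2)) := by gcongr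
      _ = β * (ε / 2) * κ * (T * κ) := by rw [hβ]; field_simp
      _ ≤ β * (ε / 2) * κ * G := by gcongr
  have hmargin : κ * (1 - ε) * (β * G) < ⨅ i, m (θ T) i := by
    obtain ⟨i, hi⟩ := exists_eq_ciInf_of_finite (f := m (θ T))
    rw [← hi]
    have h : Real.exp (-m (θ T) i) ≤ S T :=
      Finset.single_le_sum (f := fun i => Real.exp (-m (θ T) i))
        (fun _ _ => (Real.exp_pos _).le) (Finset.mem_univ i)
    have h' := h.trans (hS_le T)
    rw [← Real.exp_log hn0, ← Real.exp_add, Real.exp_le_exp] at h'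
    have h2 : β * (1 - ε / 2) * (κ * G) ≤
        β * (1 - ε / 2) * ∑ s ∈ Finset.range T, g s ^ 2 :=
      mul_le_mul_of_nonneg_left hG2 (mul_nonneg hβ0.le (by linarith))
    linarith
  have hlow : κ * (1 - ε) * ∑ j, |θ T j| < ⨅ i, m (θ T) i :=
    (mul_le_mul_of_nonneg_left (hθ_le T) (mul_nonneg hκ.le (by linarith))).trans_lt hmargin
  have hθT : θ T ≠ 0 := by
    intro h
    simp [h, hm] at hlow
  have hpos : 0 < ∑ j, |θ T j| := by
    obtain ⟨j, hj⟩ := Function.ne_iff.mp hθT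
    exact Finset.sum_pos' (fun _ _ => abs_nonneg _) ⟨j, Finset.mem_univ j, abs_pos.mpr hj⟩
  exact ⟨hθT, iInf_margin_div_le_maxMarginQ_one hn hpos, (lt_div_iff₀ hpos).mpr hlow⟩
end
end

section
/- Let n, p ≥ 1, M > 0, and let Z ∈ ℝ^{n×p} satisfy |Z_{ij}| ≤ M for all i,j. Define R⋆(x) := log(Σ_{i=1}^n exp(x_i)) for x ∈ ℝ^n. Fix θ ∈ ℝ^p, let η ∈ ℝ^n with η_i := exp(−(Zθ)_i)/Σ_{j=1}^n exp(−(Zθ)_j), let γ := ‖Zᵀη‖_∞, let v ∈ ℝ^p satisfy ‖v‖₁ ≤ 1 and ⟨Zᵀη, v⟩ = γ, and set α := γ/M². Then R⋆(−Z(θ + α·v)) ≤ R⋆(−Zθ) − γ²/(2M²). -/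
noncomputable section

open MeasureTheory ProbabilityTheory in
/-- Hoeffding's lemma for a finitely supported probability distribution with weights `η`. -/
theorem sum_mul_exp_le_of_abs_le {ι : Type*} [Fintype ι] {η w : ι → ℝ} {M : ℝ}
    (hη : ∀ i, 0 ≤ η i) (hsum : ∑ i, η i = 1) (hw : ∀ i, |w i| ≤ M) (t : ℝ) :
    ∑ i, η i * Real.exp (t * w i) ≤
      Real.exp (t * ∑ i, η i * w i + M ^ 2 * t ^ 2 / 2) := by
  let _ : MeasurableSpace ι := ⊤
  let P : PMF ι := PMF.ofFintype (fun i => ENNReal.ofReal (η i)) (by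
    rw [← ENNReal.ofReal_sum_of_nonneg fun i _ => hη i, hsum, ENNReal.ofReal_one])
  have hint (f : ι → ℝ) : ∫ i, f i ∂P.toMeasure = ∑ i, η i * f i := by
    simp [PMF.integral_eq_sum, P, hη]
  have hsub := hasSubgaussianMGF_of_mem_Icc (μ := P.toMeasure) (X := w) (a := -M) (b := M)
    (measurable_from_top).aemeasurable (ae_of_all _ fun i => abs_le.mp (hw i))
  have hmgf := hsub.mgf_le t
  simp only [mgf, hint] at hmgf
  have hexp (i : ι) : Real.exp (t * w i) =
      Real.exp (t * ∑ i, η i * w i) * Real.exp (t * (w i - ∑ i, η i * w i)) := by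
    rw [← Real.exp_add]; ring_nf
  have hc : (((‖M - -M‖₊ / 2) ^ 2 : NNReal) : ℝ) = M ^ 2 := by
    push_cast
    rw [div_pow, Real.norm_eq_abs, sq_abs]
    ring
  rw [hc] at hmgf
  calc ∑ i, η i * Real.exp (t * w i)
      = Real.exp (t * ∑ i, η i * w i) *
          ∑ i, η i * Real.exp (t * (w i - ∑ i, η i * w i)) := by
        rw [Finset.mul_sum]
        exact Finset.sum_congr rfl fun i _ => by rw [hexp i]; ring
    _ ≤ _ := by
        rw [Real.exp_add]
        gcongr

/-- **(Single-step descent inequality for boosting/mirror descent with shrunken step size).** -/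
theorem mirror_descent_single_step
    (n p : ℕ) (hn : 0 < n) (M : ℝ) (hM : 0 < M)
    (Z : Fin n → Fin p → ℝ) (hZ : ∀ i j, |Z i j| ≤ M)
    (Rstar : (Fin n → ℝ) → ℝ)
    (hR : ∀ x : Fin n → ℝ, Rstar x = Real.log (∑ i, Real.exp (x i)))
    (θ : Fin p → ℝ) (η : Fin n → ℝ)
    (hη : ∀ i, η i = Real.exp (-(∑ j, Z i j * θ j)) /
      ∑ i', Real.exp (-(∑ j, Z i' j * θ j)))
    (γ : ℝ) (hγ : γ = ⨆ j, |∑ i, Z i j * η i|)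
    (v : Fin p → ℝ) (hv_norm : (∑ j, |v j|) ≤ 1)
    (hv_max : (∑ j, (∑ i, Z i j * η i) * v j) = γ)
    (α : ℝ) (hα : α = γ / M ^ 2) :
    Rstar (fun i => -(∑ j, Z i j * (θ j + α * v j))) ≤
      Rstar (fun i => -(∑ j, Z i j * θ j)) - γ ^ 2 / (2 * M ^ 2) := by
  have : Nonempty (Fin n) := ⟨⟨0, hn⟩⟩
  set S := ∑ i', Real.exp (-(∑ j, Z i' j * θ j)) with hS
  have hSpos : 0 < S := Finset.sum_pos (fun i _ => Real.exp_pos _) Finset.univ_nonempty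
  have hη_nonneg (i : Fin n) : 0 ≤ η i := by rw [hη]; positivity
  have hη_sum : ∑ i, η i = 1 := by
    simp_rw [hη]
    rw [← Finset.sum_div, ← hS, div_self hSpos.ne']
  have hw (i : Fin n) : |∑ j, Z i j * v j| ≤ M := calc
    |∑ j, Z i j * v j| ≤ ∑ j, |Z i j * v j| := Finset.abs_sum_le_sum_abs _ _
    _ ≤ ∑ j, M * |v j| := Finset.sum_le_sum fun j _ => by
      rw [abs_mul]; exact mul_le_mul_of_nonneg_right (hZ i j) (abs_nonneg _)
    _ = M * ∑ j, |v j| := by rw [Finset.mul_sum]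
    _ ≤ M := mul_le_of_le_one_right hM.le hv_norm
  have hmean : ∑ i, η i * ∑ j, Z i j * v j = γ := by
    rw [← hv_max]
    simp_rw [Finset.mul_sum, Finset.sum_mul]
    rw [Finset.sum_comm]
    exact Finset.sum_congr rfl fun j _ => Finset.sum_congr rfl fun i _ => by ring
  have hbound := sum_mul_exp_le_of_abs_le hη_nonneg hη_sum hw (-α)
  have hexponent : -α * γ + M ^ 2 * (-α) ^ 2 / 2 = -(γ ^ 2 / (2 * M ^ 2)) := by
    rw [hα]; field_simp; ring
  rw [hmean, hexponent] at hbound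
  have hfactor : ∑ i, Real.exp (-(∑ j, Z i j * (θ j + α * v j))) =
      S * ∑ i, η i * Real.exp (-α * ∑ j, Z i j * v j) := by
    rw [Finset.mul_sum]
    refine Finset.sum_congr rfl fun i _ => ?_
    rw [hη, ← mul_assoc, mul_div_cancel₀ _ hSpos.ne', ← Real.exp_add]
    congr 1
    simp_rw [mul_add, Finset.sum_add_distrib, Finset.mul_sum]
    rw [neg_add, ← Finset.sum_neg_distrib (f := fun j => Z i j * (α * v j))]
    congr 1
    exact Finset.sum_congr rfl fun j _ => by ring
  rw [hR, hR, hfactor, ← hS, sub_eq_add_neg, ← Real.log_exp (-(γ ^ 2 / (2 * M ^ 2))),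
    ← Real.log_mul hSpos.ne' (Real.exp_ne_zero _)]
  refine Real.log_le_log ?_ (mul_le_mul_of_nonneg_left hbound hSpos.le)
  rw [← hfactor]
  exact Finset.sum_pos (fun i _ => Real.exp_pos _) Finset.univ_nonempty
end
end
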